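/- arXiv:math/0011119 — 2 statements merged into one kernel-verified Lean document; each statement's English description precedes it below -/
import Mathlib

section
/- Let r be a prime, s a positive integer, and let a and b be positive integers with gcd(a, b) = 1, r ∤ a and r ∤ b. Set g = (a − 1)(b − 1)/2 (an integer, since a and b are not both even). If the polynomial Δ_{a,b}(t) − t^g lies in the ideal of ℤ[t] generated by t^(r^s) − 1 and r, then a ≡ ±1 (mod r^s) or b ≡ ±1 (mod r^s). -/
open Polynomial

namespace TorusKnot

/-- The linear functional on `ℤ[X]` with values in `R` that sends `X ^ k` to `u k`. -/
noncomputable def functional {R : Type*} [CommRing R] (u : ℕ → R) : ℤ[X] →ₗ[ℤ] R :=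
  Polynomial.lsum fun k => LinearMap.toSpanSingleton ℤ R (u k)

lemma functional_X_pow {R : Type*} [CommRing R] (u : ℕ → R) (k : ℕ) :
    functional u (X ^ k) = u k := by
  simp [functional, Polynomial.lsum_apply, ← Polynomial.monomial_one_right_eq_X_pow,
    Polynomial.sum_monomial_index]

lemma functional_mul_eq_zero {R : Type*} [CommRing R] (u : ℕ → R) (q : ℤ[X])
    (h : ∀ k, functional u (q * X ^ k) = 0) (w : ℤ[X]) : functional u (q * w) = 0 := by
  induction w using Polynomial.induction_on' with
  | add p p' hp hp' => rw [mul_add, map_add, hp, hp', add_zero]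
  | monomial k c =>
    rw [← Polynomial.smul_X_eq_monomial, mul_smul_comm, map_smul, h, smul_zero]

/-- If a sequence is annihilated by `(X ^ n - 1) * (X - 1) ^ 2`, it satisfies the linear relation
given by the exponents of `(1 - X) (1 - X ^ (ab)) - X ^ g (1 - X ^ a) (1 - X ^ b)`. -/
lemma exponent_relation {r n a b g : ℕ} {Δ : ℤ[X]}
    (hΔ : Δ * ((1 - X ^ a) * (1 - X ^ b)) = (1 - X) * (1 - X ^ (a * b)))
    (hmem : Δ - X ^ g ∈ Ideal.span {(X ^ n - 1 : ℤ[X]), ((r : ℤ) : ℤ[X])})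
    (u : ℕ → ZMod r)
    (hu : ∀ k, u (k + n + 2) - 2 * u (k + n + 1) + u (k + n)
      - (u (k + 2) - 2 * u (k + 1) + u k) = 0) :
    u 0 + u (a * b + 1) + u (g + a) + u (g + b) =
      u 1 + u (a * b) + u g + u (g + a + b) := by
  obtain ⟨A, B, hAB⟩ := Ideal.mem_span_pair.1 hmem
  obtain ⟨P, hP⟩ : (1 - X : ℤ[X]) ∣ 1 - X ^ a := by
    simpa using sub_dvd_pow_sub_pow (1 : ℤ[X]) X a
  obtain ⟨Q, hQ⟩ : (1 - X : ℤ[X]) ∣ 1 - X ^ b := by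
    simpa using sub_dvd_pow_sub_pow (1 : ℤ[X]) X b
  have hmul : ((X ^ n - 1) * (X - 1) ^ 2) * (A * P * Q)
      + (r : ℤ) • (B * ((1 - X ^ a) * (1 - X ^ b)))
      = X ^ 0 - X ^ 1 - X ^ (a * b) + X ^ (a * b + 1)
        - X ^ g + X ^ (g + a) + X ^ (g + b) - X ^ (g + a + b) := by
    rw [zsmul_eq_mul]
    calc _ = (A * (X ^ n - 1) + B * ((r : ℤ) : ℤ[X])) * ((1 - X ^ a) * (1 - X ^ b)) := by
          rw [hP, hQ]; ring
      _ = (1 - X) * (1 - X ^ (a * b)) - X ^ g * ((1 - X ^ a) * (1 - X ^ b)) := by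
          rw [hAB, sub_mul, hΔ]
      _ = _ := by ring
  have hzero := functional_mul_eq_zero u ((X ^ n - 1) * (X - 1) ^ 2) (fun k => by
    have : ((X ^ n - 1) * (X - 1) ^ 2 * X ^ k : ℤ[X]) =
        X ^ (k + n + 2) - (2 : ℤ) • X ^ (k + n + 1) + X ^ (k + n)
          - (X ^ (k + 2) - (2 : ℤ) • X ^ (k + 1) + X ^ k) := by
      simp only [zsmul_eq_mul]; push_cast; ring
    rw [this]
    simp only [map_sub, map_add, map_smul, functional_X_pow]
    simp only [zsmul_eq_mul]
    exact_mod_cast hu k) (A * P * Q)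
  have := congrArg (functional u) hmul
  simp only [map_sub, map_add, map_smul, functional_X_pow, hzero] at this
  simp only [zsmul_eq_mul, Int.cast_natCast, CharP.cast_eq_zero, zero_mul] at this
  linear_combination -this

/-- The exponents, taken modulo `n`, have vanishing signed count modulo `r` in each class. -/
lemma residue_relation {r n a b g : ℕ} {Δ : ℤ[X]}
    (hΔ : Δ * ((1 - X ^ a) * (1 - X ^ b)) = (1 - X) * (1 - X ^ (a * b)))
    (hmem : Δ - X ^ g ∈ Ideal.span {(X ^ n - 1 : ℤ[X]), ((r : ℤ) : ℤ[X])}) (c : ZMod n) :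
    ((if 0 = c then 1 else 0) + (if (a * b + 1 : ZMod n) = c then 1 else 0)
      + (if (g + a : ZMod n) = c then 1 else 0) + (if (g + b : ZMod n) = c then 1 else 0)
      : ZMod r) =
    (if 1 = c then 1 else 0) + (if (a * b : ZMod n) = c then 1 else 0)
      + (if (g : ZMod n) = c then 1 else 0)
      + (if (g + a + b : ZMod n) = c then 1 else 0) := by
  have := exponent_relation hΔ hmem (fun k => if (k : ZMod n) = c then 1 else 0)
    (fun k => by simp)
  simpa using this

lemma eq_of_odd_prime {r n a b g : ℕ} (hr : r.Prime) (hr2 : r ≠ 2)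
    (h2 : IsUnit (2 : ZMod n)) (ha : IsUnit (a : ZMod n)) (hb : IsUnit (b : ZMod n))
    (h10 : (1 : ZMod n) ≠ 0)
    (hg : (2 * g : ZMod n) = (a - 1) * (b - 1))
    (H : ∀ c : ZMod n,
    ((if 0 = c then 1 else 0) + (if (a * b + 1 : ZMod n) = c then 1 else 0)
      + (if (g + a : ZMod n) = c then 1 else 0) + (if (g + b : ZMod n) = c then 1 else 0)
      : ZMod r) =
    (if 1 = c then 1 else 0) + (if (a * b : ZMod n) = c then 1 else 0)
      + (if (g : ZMod n) = c then 1 else 0)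
      + (if (g + a + b : ZMod n) = c then 1 else 0)) :
    (a : ZMod n) = 1 ∨ (a : ZMod n) = -1 ∨ (b : ZMod n) = 1 ∨ (b : ZMod n) = -1 := by
  have hk : ∀ k : ℕ, 0 < k → k ≤ 4 → k ≠ 3 → (k : ZMod r) ≠ 0 := by
    intro k hk0 hk4 hk3 h
    rw [ZMod.natCast_eq_zero_iff] at h
    have h2r := hr.two_le
    have := Nat.le_of_dvd hk0 h
    interval_cases k <;> interval_cases r <;> revert hr h <;> simp_all <;> decide
  have e1 : (1 : ZMod r) ≠ 0 := by simpa using hk 1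
  have e2 : (1 + 1 : ZMod r) ≠ 0 := by
    have := hk 2 (by norm_num) (by norm_num) (by norm_num)
    norm_num at this ⊢; exact this
  have e4 : (1 + 1 + 1 + 1 : ZMod r) ≠ 0 := by
    have := hk 4 (by norm_num) (by norm_num) (by norm_num)
    norm_num at this ⊢; exact this
  generalize (a : ZMod n) = x at *
  generalize (b : ZMod n) = y at *
  generalize (g : ZMod n) = z at *
  have hc2 : ∀ w v : ZMod n, 2 * w = 2 * v → w = v := fun w v h => h2.mul_left_cancel h
  have hx0 : x ≠ 0 := fun h => h10 (by rw [h] at ha; exact (isUnit_zero_iff.1 ha).symm)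
  have hy0 : y ≠ 0 := fun h => h10 (by rw [h] at hb; exact (isUnit_zero_iff.1 hb).symm)
  have hxy : x * y ≠ 0 := fun h => hx0 (by
    have : x * y = 0 * y := by rw [h, zero_mul]
    exact hb.mul_right_cancel this)
  have first : (x - 1) * (y - 1) = 0 ∨ (x + 1) * (y + 1) = 0 := by
    by_contra! hcon
    have n1 : z ≠ 0 := fun h => hcon.1 (by rw [← hg, h, mul_zero])
    have n2 : z + x + y ≠ 0 := fun h => hcon.2 (by linear_combination 2 * h - hg)
    have h := H 0
    rw [if_pos rfl, if_neg h10, if_neg hxy, if_neg n1, if_neg n2] at h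
    by_cases p1 : x * y + 1 = 0 <;> by_cases p2 : z + x = 0 <;> by_cases p3 : z + y = 0
    · simp [p1, p2, p3] at h; exact e4 (by linear_combination h)
    · exact p3 (hc2 _ _ (by linear_combination 2 * p1 + 2 * hg - 2 * p2))
    · exact p2 (hc2 _ _ (by linear_combination 2 * p1 + 2 * hg - 2 * p3))
    · simp [p1, p2, p3] at h; exact e2 (by linear_combination h)
    · exact p1 (by linear_combination p2 + p3 - hg)
    · simp [p1, p2, p3] at h; exact e2 (by linear_combination h)
    · simp [p1, p2, p3] at h; exact e2 (by linear_combination h)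
    · simp [p1, p2, p3] at h; exact e1 (by linear_combination h)
  have second : (x - 1) * (y + 1) = 0 ∨ (x + 1) * (y - 1) = 0 := by
    by_contra! hcon
    have n1 : 1 ≠ z + x := fun h => hcon.1 (by linear_combination -2 * h - hg)
    have n2 : x * y ≠ z + x := fun h => hcon.2 (by linear_combination 2 * h + hg)
    have n3 : z ≠ z + x := fun h => hx0 (by linear_combination -h)
    have n4 : z + x + y ≠ z + x := fun h => hy0 (by linear_combination h)
    have h := H (z + x)
    rw [if_neg n1, if_neg n2, if_neg n3, if_neg n4, if_pos (rfl : z + x = z + x)] at h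
    by_cases p1 : 0 = z + x <;> by_cases p2 : x * y + 1 = z + x <;>
      by_cases p3 : z + y = z + x
    · rw [if_pos p1, if_pos p2, if_pos p3] at h; exact e4 (by linear_combination h)
    · exact p3 (by linear_combination hg + p1 + p2)
    · exact p2 (by linear_combination -hg - p1 + p3)
    · rw [if_pos p1, if_neg p2, if_neg p3] at h; exact e2 (by linear_combination h)
    · exact p1 (by linear_combination -hg - p2 + p3)
    · rw [if_neg p1, if_pos p2, if_neg p3] at h; exact e2 (by linear_combination h)
    · rw [if_neg p1, if_neg p2, if_pos p3] at h; exact e2 (by linear_combination h)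
    · rw [if_neg p1, if_neg p2, if_neg p3] at h; exact e1 (by linear_combination h)
  rcases first with h | h <;> rcases second with h' | h'
  · exact Or.inl (hc2 _ _ (by linear_combination h' - h))
  · exact Or.inr (Or.inr (Or.inl (hc2 _ _ (by linear_combination h' - h))))
  · exact Or.inr (Or.inr (Or.inr (hc2 _ _ (by linear_combination h - h'))))
  · exact Or.inr (Or.inl (hc2 _ _ (by linear_combination h - h')))

/-- In characteristic two, among the even (respectively odd) exponents the quotients by `n`
have even sum. -/
lemma floor_relation {n a b g : ℕ} (hn2 : 2 ≤ n) (hn : Even n) {Δ : ℤ[X]}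
    (hΔ : Δ * ((1 - X ^ a) * (1 - X ^ b)) = (1 - X) * (1 - X ^ (a * b)))
    (hmem : Δ - X ^ g ∈ Ideal.span {(X ^ n - 1 : ℤ[X]), (((2 : ℕ) : ℤ) : ℤ[X])})
    (ha : Odd a) (hb : Odd b) (hg : Even g) :
    Even ((a * b + 1) / n + g / n + (g + a + b) / n) ∧
      Even ((a * b) / n + (g + a) / n + (g + b) / n) := by
  have hn0 : 0 < n := by omega
  have two0 : (2 : ZMod 2) = 0 := rfl
  have h1 : 1 / n = 0 := Nat.div_eq_of_lt (by omega)
  have e1 : Even (a * b + 1) := (ha.mul hb).add_one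
  have e2 : Even (g + a + b) := by rw [add_assoc]; exact hg.add (ha.add_odd hb)
  have o1 : ¬ Even (a * b) := Nat.not_even_iff_odd.2 (ha.mul hb)
  have o2 : ¬ Even (g + a) := Nat.not_even_iff_odd.2 (hg.add_odd ha)
  have o3 : ¬ Even (g + b) := Nat.not_even_iff_odd.2 (hg.add_odd hb)
  constructor
  · have := exponent_relation hΔ hmem (fun k => if Even k then ((k / n : ℕ) : ZMod 2) else 0)
      (fun k => by
        have q1 : (k + n + 2) / n = (k + 2) / n + 1 := by
          rw [add_right_comm, Nat.add_div_right _ hn0]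
        have q2 : (k + n) / n = k / n + 1 := Nat.add_div_right _ hn0
        by_cases hk : Even k <;> simp [hk, hn, q1, q2, two0, parity_simps]
        linear_combination two0)
    simp only [e1, e2, o1, o2, o3, hg, if_true, if_false, Nat.not_even_one, Nat.zero_div,
      Nat.cast_zero, add_zero, zero_add, Even.zero, ite_self] at this
    rw [← ZMod.natCast_eq_zero_iff_even]
    push_cast
    linear_combination this + (((g / n : ℕ) : ZMod 2) + ((g + a + b) / n : ℕ)) * two0
  · have := exponent_relation hΔ hmem (fun k => if Even k then 0 else ((k / n : ℕ) : ZMod 2))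
      (fun k => by
        have q1 : (k + n + 2) / n = (k + 2) / n + 1 := by
          rw [add_right_comm, Nat.add_div_right _ hn0]
        have q2 : (k + n) / n = k / n + 1 := Nat.add_div_right _ hn0
        by_cases hk : Even k <;> simp [hk, hn, q1, q2, two0, parity_simps]
        linear_combination two0)
    simp only [e1, e2, o1, o2, o3, hg, if_true, if_false, Nat.not_even_one, h1,
      Nat.cast_zero, add_zero, zero_add, Even.zero] at this
    rw [← ZMod.natCast_eq_zero_iff_even]
    push_cast
    linear_combination this + (((a * b) / n : ℕ) : ZMod 2) * two0

lemma eq_of_even {n a b g : ℕ} (hn : Even n) (hn2 : 2 ≤ n) (ha : Odd a) (hb : Odd b)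
    (hg : Even g) (h2g : 2 * g + a + b = a * b + 1) {Δ : ℤ[X]}
    (hΔ : Δ * ((1 - X ^ a) * (1 - X ^ b)) = (1 - X) * (1 - X ^ (a * b)))
    (hmem : Δ - X ^ g ∈ Ideal.span {(X ^ n - 1 : ℤ[X]), (((2 : ℕ) : ℤ) : ℤ[X])}) :
    (a : ZMod n) = 1 ∨ (a : ZMod n) = -1 ∨ (b : ZMod n) = 1 ∨ (b : ZMod n) = -1 := by
  have H := residue_relation hΔ hmem
  obtain ⟨F1, F2⟩ := floor_relation hn2 hn hΔ hmem ha hb hg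
  have hn0 : 0 < n := by omega
  have parity : ∀ i j : ℕ, (i : ZMod n) = j → (Even i ↔ Even j) := by
    intro i j h
    rw [ZMod.natCast_eq_natCast_iff] at h
    have := h.of_dvd hn.two_dvd
    rw [Nat.even_iff, Nat.even_iff, this]
  have hZ : (2 * g + a + b : ZMod n) = a * b + 1 := by exact_mod_cast congrArg (Nat.cast) h2g
  have par : ∀ i j : ℕ, Even i → Odd j → (i : ZMod n) ≠ j := fun i j hi hj h =>
    (Nat.not_even_iff_odd.2 hj) ((parity i j h).1 hi)
  have e1 : Even (a * b + 1) := (ha.mul hb).add_one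
  have e2 : Even (g + a + b) := by rw [add_assoc]; exact hg.add (ha.add_odd hb)
  have o1 : Odd (a * b) := ha.mul hb
  have o2 : Odd (g + a) := hg.add_odd ha
  have o3 : Odd (g + b) := hg.add_odd hb
  have even_case : (g : ZMod n) = 0 ∨ (g + a + b : ZMod n) = 0 := by
    by_contra! hcon
    obtain ⟨k1, k2⟩ := hcon
    have m1 : (0 : ZMod n) ≠ 1 := by simpa using par 0 1 (by simp) (by simp)
    have m2 : (0 : ZMod n) ≠ a * b := by simpa using par 0 _ (by simp) o1
    have m3 : (0 : ZMod n) ≠ g + a := by simpa using par 0 _ (by simp) o2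
    have m4 : (0 : ZMod n) ≠ g + b := by simpa using par 0 _ (by simp) o3
    have l1 : (g : ZMod n) ≠ 1 := by simpa using par g 1 hg (by simp)
    have l2 : (g : ZMod n) ≠ a * b := by simpa using par g _ hg o1
    have l3 : (g : ZMod n) ≠ g + a := by simpa using par g _ hg o2
    have l4 : (g : ZMod n) ≠ g + b := by simpa using par g _ hg o3
    have p1 : (a * b + 1 : ZMod n) = 0 := by
      by_contra p1
      have h := H 0
      rw [if_pos rfl, if_neg p1, if_neg m3.symm, if_neg m4.symm, if_neg m1.symm, if_neg m2.symm,
        if_neg k1, if_neg k2] at h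
      simp at h
    have p2 : (g + a + b : ZMod n) = g := by
      by_contra p2
      have h := H g
      rw [if_neg (Ne.symm k1), if_neg (by rwa [p1, eq_comm]), if_neg l3.symm, if_neg l4.symm,
        if_neg l1.symm, if_neg l2.symm, if_pos rfl, if_neg p2] at h
      simp at h
    have d1 : n ∣ a * b + 1 := by
      rw [← ZMod.natCast_eq_zero_iff]; exact_mod_cast p1
    have d2 : n ∣ a + b := by
      rw [← ZMod.natCast_eq_zero_iff]; push_cast; linear_combination p2
    obtain ⟨i, hi⟩ := d1
    obtain ⟨j, hj⟩ := d2
    rw [add_assoc g, hj, hi, Nat.add_mul_div_left _ _ hn0, Nat.mul_div_cancel_left _ hn0] at F1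
    have hij : Even (i + j) := by
      rw [Nat.even_iff] at F1 ⊢; omega
    obtain ⟨t, ht⟩ := hij
    apply k1
    have : (g : ℤ) = n * (t - j) := by
      zify at *
      linarith [congrArg (fun v : ℤ => n * v) ht, mul_add (n : ℤ) i j, mul_add (n : ℤ) t t,
        mul_sub (n : ℤ) t j]
    have := congrArg (Int.cast : ℤ → ZMod n) this
    simpa using this
  have odd_case : (g + a : ZMod n) = 1 ∨ (g + b : ZMod n) = 1 := by
    by_contra! hcon
    obtain ⟨k1, k2⟩ := hcon
    have m1 : (0 : ZMod n) ≠ 1 := by simpa using par 0 1 (by simp) (by simp)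
    have m2 : (a * b + 1 : ZMod n) ≠ 1 := by simpa using par _ 1 e1 (by simp)
    have m3 : (g : ZMod n) ≠ 1 := by simpa using par g 1 hg (by simp)
    have m4 : (g + a + b : ZMod n) ≠ 1 := by simpa using par _ 1 e2 (by simp)
    have l1 : (0 : ZMod n) ≠ g + a := by simpa using par 0 _ (by simp) o2
    have l2 : (a * b + 1 : ZMod n) ≠ g + a := by simpa using par _ _ e1 o2
    have l3 : (g : ZMod n) ≠ g + a := by simpa using par g _ hg o2
    have l4 : (g + a + b : ZMod n) ≠ g + a := by simpa using par _ _ e2 o2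
    have p1 : (a * b : ZMod n) = 1 := by
      by_contra p1
      have h := H 1
      rw [if_neg m1, if_neg m2, if_neg k1, if_neg k2, if_pos rfl, if_neg p1,
        if_neg m3, if_neg m4] at h
      simp at h
    have p2 : (g + b : ZMod n) = g + a := by
      by_contra p2
      have h := H (g + a)
      rw [if_neg l1, if_neg l2, if_pos rfl, if_neg p2, if_neg (Ne.symm k1),
        if_neg (by rw [p1]; exact Ne.symm k1), if_neg l3, if_neg l4] at h
      simp at h
    have hab1 : 1 ≤ a * b := Nat.mul_pos ha.pos hb.pos
    obtain ⟨i, hi⟩ : n ∣ a * b - 1 := by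
      rw [← ZMod.natCast_eq_zero_iff, Nat.cast_sub hab1]; push_cast; linear_combination p1
    have hi' : a * b = 1 + n * i := by omega
    obtain ⟨j, hj⟩ : (n : ℤ) ∣ a - b := by
      rw [← ZMod.intCast_zmod_eq_zero_iff_dvd]; push_cast; linear_combination -p2
    have hdiv : ((g + a : ℕ) : ℤ) / n = ((g + b : ℕ) : ℤ) / n + j := by
      rw [← Int.add_mul_ediv_left _ _ (by exact_mod_cast hn0.ne')]
      congr 1; push_cast; linarith
    have hij : Even ((i : ℤ) + j) := by
      rw [hi', Nat.add_mul_div_left _ _ hn0, Nat.div_eq_of_lt (by omega : 1 < n)] at F2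
      rw [← Int.even_coe_nat] at F2
      push_cast at F2 hdiv
      rw [hdiv] at F2
      rw [Int.even_iff] at F2 ⊢; omega
    obtain ⟨t, ht⟩ := hij
    apply k1
    have : (g + a : ℤ) = 1 + n * t := by
      zify at h2g hi'
      linarith [congrArg (fun v : ℤ => n * v) ht, mul_add (n : ℤ) i j, mul_add (n : ℤ) t t]
    have := congrArg (Int.cast : ℤ → ZMod n) this
    simpa using this
  rcases even_case with h | h <;> rcases odd_case with h' | h'
  · exact Or.inl (by linear_combination h' - h)
  · exact Or.inr (Or.inr (Or.inl (by linear_combination h' - h)))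
  · exact Or.inr (Or.inr (Or.inr (by linear_combination h - h')))
  · exact Or.inr (Or.inl (by linear_combination h - h'))

end TorusKnot

/-- Let `r` be a prime, `s` a positive integer, and `a`, `b` coprime positive integers
not divisible by `r`.  Let `Δ` be the (unique) polynomial with
`Δ(t)·(1 - t^a)(1 - t^b) = (1 - t)(1 - t^(ab))` and let `g = (a-1)(b-1)/2`.
If `Δ(t) - t^g` lies in the ideal of `ℤ[t]` generated by `t^(r^s) - 1` and `r`,
then `a ≡ ±1 (mod r^s)` or `b ≡ ±1 (mod r^s)`. -/
theorem torus_knot_alexander_trivial_mod (r s a b : ℕ) (hr : r.Prime) (hs : 0 < s)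
    (ha : 0 < a) (hb : 0 < b) (hab : Nat.gcd a b = 1) (hra : ¬ r ∣ a) (hrb : ¬ r ∣ b)
    (Δ : Polynomial ℤ)
    (hΔ : Δ * ((1 - X ^ a) * (1 - X ^ b)) = (1 - X) * (1 - X ^ (a * b)))
    (g : ℕ) (hg : 2 * g = (a - 1) * (b - 1))
    (hmem : Δ - X ^ g ∈ Ideal.span {(X ^ (r ^ s) - 1 : Polynomial ℤ),
      ((r : ℤ) : Polynomial ℤ)}) :
    (a : ZMod (r ^ s)) = 1 ∨ (a : ZMod (r ^ s)) = -1 ∨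
      (b : ZMod (r ^ s)) = 1 ∨ (b : ZMod (r ^ s)) = -1 := by
  rcases eq_or_ne r 2 with rfl | hr2
  · have hao : Odd a := by rw [← Nat.not_even_iff_odd, even_iff_two_dvd]; exact hra
    have hbo : Odd b := by rw [← Nat.not_even_iff_odd, even_iff_two_dvd]; exact hrb
    obtain ⟨p, rfl⟩ := hao
    obtain ⟨q, rfl⟩ := hbo
    have hge : g = 2 * (p * q) := by
      simp only [Nat.add_sub_cancel] at hg
      linarith
    refine TorusKnot.eq_of_even (Nat.even_pow.2 ⟨even_two, hs.ne'⟩)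
      (Nat.le_self_pow hs.ne' 2) ⟨p, rfl⟩ ⟨q, rfl⟩ ⟨p * q, by omega⟩ ?_ hΔ hmem
    rw [hge]; ring
  · have unit_of : ∀ m : ℕ, ¬ r ∣ m → IsUnit (m : ZMod (r ^ s)) := fun m hm =>
      (ZMod.isUnit_iff_coprime m (r ^ s)).2
        (((Nat.Prime.coprime_iff_not_dvd hr).2 hm).symm.pow_right s)
    have : Fact (1 < r ^ s) := ⟨Nat.one_lt_pow hs.ne' hr.one_lt⟩
    refine TorusKnot.eq_of_odd_prime hr hr2 ?_ (unit_of a hra) (unit_of b hrb) one_ne_zero ?_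
      (TorusKnot.residue_relation hΔ hmem)
    · exact_mod_cast unit_of 2 fun h => hr2 ((Nat.prime_dvd_prime_iff_eq hr Nat.prime_two).1 h)
    · have := congrArg (Nat.cast : ℕ → ZMod (r ^ s)) hg
      push_cast [Nat.cast_sub (show 1 ≤ a from ha), Nat.cast_sub (show 1 ≤ b from hb)] at this
      exact this
end

section
/- Let p and q be positive integers with gcd(p, q) = 1, let n be a positive integer with gcd(n, p) = 1 and 0 < p − qn, and set g = (n(p−qn) + 1 − (p−qn+n))/2 (an integer, since n and p−qn are coprime and hence not both even). Let r be a prime and s a positive integer with r^s dividing p, and let Δ ∈ ℤ[t] be the unique polynomial with Δ(t)·(1−t^n)(1−t^{p−qn}) = (1−t)(1−t^{n(p−qn)}). If Δ(t) − t^g lies in the ideal of ℤ[t] generated by t^(r^s) − 1 and r, then n² ≡ 1 (mod r^s) or q²n² ≡ 1 (mod r^s). -/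
open Polynomial

/-- If `X ^ g * (1 - X ^ a) * (1 - X ^ b)` and `(1 - X) * (1 - X ^ (a * b))` agree in the group
algebra of `R` over `K`, where `2` is a unit of `R` and nonzero in `K`, then
`a ^ 2 = 1` or `b ^ 2 = 1`. -/
lemma sq_eq_one_or_of_two_ne_zero {R K : Type*} [CommRing R] [Nontrivial R] [DecidableEq R]
    [CommRing K] [Nontrivial K] (h2R : IsUnit (2 : R)) (h2K : (2 : K) ≠ 0) {a b g : R}
    (ha : IsUnit a) (hb : IsUnit b)
    (h : ∀ x : R, (if g = x then 1 else 0) + (if g + a + b = x then 1 else 0)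
        - (if g + a = x then 1 else 0) - (if g + b = x then 1 else 0)
      = (if 0 = x then 1 else 0) + (if a * b + 1 = x then 1 else 0)
        - (if 1 = x then 1 else 0) - (if a * b = x then (1 : K) else 0)) :
    a ^ 2 = 1 ∨ b ^ 2 = 1 := by
  have ha0 : a ≠ 0 := ha.ne_zero
  have hb0 : b ≠ 0 := hb.ne_zero
  have hab0 : a * b ≠ 0 := (ha.mul hb).ne_zero
  have h1R : (1 : R) ≠ 0 := one_ne_zero
  have h2R0 : (2 : R) ≠ 0 := h2R.ne_zero
  have h2a : 2 * a ≠ 0 := (h2R.mul ha).ne_zero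
  have h2b : 2 * b ≠ 0 := (h2R.mul hb).ne_zero
  have h1K : (1 : K) ≠ 0 := one_ne_zero
  by_cases h_neg : a * b = -1
  · by_cases h_add : a + b = 0
    · grind
    have := h g
    grind
  by_cases h_pos : a * b = 1
  · by_cases h_eq : a = b
    · grind
    have := h (g + a)
    grind
  by_cases h_add : a + b = 0
  · have := h 0
    grind
  by_cases h_eq : a = b
  · have := h 1
    grind
  have h_zero : g = 0 ∨ g + a + b = 0 := by
    have := h 0
    grind
  have h_one : g + a = 1 ∨ g + b = 1 := by
    have := h 1
    grind
  grind

/-- If `X ^ g * (1 - X ^ a) * (1 - X ^ b)` and `(1 - X) * (1 - X ^ (a * b))` agree in the group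
algebra of `R` over `K`, where `R` admits a homomorphism to `ZMod 2`, then `a ^ 2 = 1` or
`b ^ 2 = 1`, provided that `a ^ 2 = -1` only holds if `a ^ 2 = 1`. -/
lemma sq_eq_one_or_of_parity {R K : Type*} [CommRing R] [DecidableEq R]
    [CommRing K] [Nontrivial K] (φ : R →+* ZMod 2) {a b g : R}
    (ha : IsUnit a) (hb : IsUnit b) (hsq : a ^ 2 = -1 → a ^ 2 = 1)
    (h : ∀ x : R, (if g = x then 1 else 0) + (if g + a + b = x then 1 else 0)
        - (if g + a = x then 1 else 0) - (if g + b = x then 1 else 0)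
      = (if 0 = x then 1 else 0) + (if a * b + 1 = x then 1 else 0)
        - (if 1 = x then 1 else 0) - (if a * b = x then (1 : K) else 0)) :
    a ^ 2 = 1 ∨ b ^ 2 = 1 := by
  have h1K : (1 : K) ≠ 0 := one_ne_zero
  have unit_eq_one : ∀ u : ZMod 2, IsUnit u → u = 1 := by decide
  have hφa := unit_eq_one _ (ha.map φ)
  have hφb := unit_eq_one _ (hb.map φ)
  have h01 : (0 : ZMod 2) ≠ 1 := by decide
  have h11 : (1 : ZMod 2) + 1 = 0 := by decide
  have hne : ∀ {x y : R}, φ x = 0 → φ y = 1 → x ≠ y := by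
    rintro x _ hx hy rfl
    exact h01 (hx.symm.trans hy)
  have hφg : φ g = 0 ∨ φ g = 1 := by
    generalize φ g = u
    revert u
    decide
  have hφab : φ (a * b) = 1 := by simp [hφa, hφb]
  have hφab1 : φ (a * b + 1) = 0 := by simp [hφa, hφb, h11]
  rcases hφg with hg | hg
  · have hga : φ (g + a) = 1 := by simp [hg, hφa]
    have hgb : φ (g + b) = 1 := by simp [hg, hφb]
    have hgab : φ (g + a + b) = 0 := by simp [hg, hφa, hφb, h11]
    have h_even : ∀ x : R, φ x = 0 →
        (if g = x then 1 else 0) + (if g + a + b = x then 1 else 0)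
          = (if 0 = x then 1 else 0) + (if a * b + 1 = x then (1 : K) else 0) := by
      intro x hx
      simpa [(hne hx hga).symm, (hne hx hgb).symm, (hne hx (map_one φ)).symm,
        (hne hx hφab).symm] using h x
    have h_odd : ∀ x : R, φ x = 1 →
        (if g + a = x then 1 else 0) + (if g + b = x then 1 else 0)
          = (if 1 = x then 1 else 0) + (if a * b = x then (1 : K) else 0) := by
      intro x hx
      have := h x
      rw [if_neg (hne hg hx), if_neg (hne hgab hx), if_neg (hne (map_zero φ) hx),
        if_neg (hne hφab1 hx)] at this
      linear_combination -this
    by_cases h_neg : a * b = -1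
    · have := h_even g hg
      grind
    by_cases h_pos : a * b = 1
    · have := h_odd (g + a) hga
      grind
    have h_zero : g = 0 ∨ g + a + b = 0 := by
      have := h_even 0 (map_zero φ)
      grind
    have h_one : g + a = 1 ∨ g + b = 1 := by
      have := h_odd 1 (map_one φ)
      grind
    grind
  · have hga : φ (g + a) = 0 := by simp [hg, hφa, h11]
    have hgb : φ (g + b) = 0 := by simp [hg, hφb, h11]
    have hgab : φ (g + a + b) = 1 := by simp [hg, hφa, hφb, h11]
    have h_even : ∀ x : R, φ x = 0 →
        -(if g + a = x then 1 else 0) - (if g + b = x then 1 else 0)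
          = (if 0 = x then 1 else 0) + (if a * b + 1 = x then (1 : K) else 0) := by
      intro x hx
      simpa [(hne hx hg).symm, (hne hx hgab).symm, (hne hx (map_one φ)).symm,
        (hne hx hφab).symm] using h x
    have h_odd : ∀ x : R, φ x = 1 →
        (if g = x then 1 else 0) + (if g + a + b = x then 1 else 0)
          = -(if 1 = x then 1 else 0) - (if a * b = x then (1 : K) else 0) := by
      intro x hx
      simpa [hne hga hx, hne hgb hx, hne (map_zero φ) hx, hne hφab1 hx] using h x
    by_cases h_neg : a * b = -1
    · have := h_even (g + a) hga
      grind
    by_cases h_pos : a * b = 1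
    · have := h_odd g hg
      grind
    have h_zero : g + a = 0 ∨ g + b = 0 := by
      have := h_even 0 (map_zero φ)
      grind
    have h_one : g = 1 ∨ g + a + b = 1 := by
      have := h_odd 1 (map_one φ)
      grind
    grind

/-- If `Δ * (1 - X ^ a) * (1 - X ^ b) = (1 - X) * (1 - X ^ (a * b))` and `Δ` is congruent to `X ^ g`
modulo `X ^ N - 1` and `r`, then the coefficients of `X ^ g * (1 - X ^ a) * (1 - X ^ b)` and
`(1 - X) * (1 - X ^ (a * b))` in the group algebra of `ZMod N` over `ZMod r` agree. -/
lemma coeff_eq_of_sub_X_pow_mem {N r a b g : ℕ} {Δ : ℤ[X]}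
    (hΔ : Δ * ((1 - X ^ a) * (1 - X ^ b)) = (1 - X) * (1 - X ^ (a * b)))
    (hmem : Δ - X ^ g ∈ Ideal.span {(X ^ N - 1 : ℤ[X]), ((r : ℤ) : ℤ[X])}) (x : ZMod N) :
    (if (g : ZMod N) = x then 1 else 0) + (if (g + a + b : ZMod N) = x then 1 else 0)
        - (if (g + a : ZMod N) = x then 1 else 0) - (if (g + b : ZMod N) = x then 1 else 0)
      = (if 0 = x then 1 else 0) + (if (a * b + 1 : ZMod N) = x then 1 else 0)
        - (if 1 = x then 1 else 0) - (if (a * b : ZMod N) = x then (1 : ZMod r) else 0) := by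
  let T : AddMonoidAlgebra (ZMod r) (ZMod N) := AddMonoidAlgebra.single 1 1
  have T_pow (k : ℕ) : T ^ k = AddMonoidAlgebra.single (k : ZMod N) 1 := by
    simp [T, AddMonoidAlgebra.single_pow]
  have T_pow_N : T ^ N = 1 := by
    rw [T_pow, ZMod.natCast_self, AddMonoidAlgebra.one_def]
  have r_eq_zero : (r : AddMonoidAlgebra (ZMod r) (ZMod N)) = 0 := by
    rw [← map_natCast (algebraMap (ZMod r) (AddMonoidAlgebra (ZMod r) (ZMod N))),
      ZMod.natCast_self, map_zero]
  have h_ker : Ideal.span {(X ^ N - 1 : ℤ[X]), ((r : ℤ) : ℤ[X])} ≤ RingHom.ker (aeval T) := by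
    rw [Ideal.span_le]
    rintro f (rfl | rfl)
    · simp [T_pow_N]
    · simp [r_eq_zero]
  have hΔT : aeval T Δ = T ^ g := by
    simpa [RingHom.mem_ker, sub_eq_zero] using h_ker hmem
  have key : T ^ g + T ^ (g + a + b) - T ^ (g + a) - T ^ (g + b)
      = T ^ 0 + T ^ (a * b + 1) - T ^ 1 - T ^ (a * b) := by
    have := congrArg (aeval T) hΔ
    simp only [map_mul, map_sub, map_one, map_pow, aeval_X, hΔT] at this
    linear_combination this
  simp only [T_pow] at key
  simpa [Finsupp.single_apply] using congrArg (fun f ↦ f.coeff x) key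

/-- Let `p, q` be coprime positive integers, `n` a positive integer coprime to `p` with
`q·n < p`, and `g = (n(p-qn) + 1 - (p-qn+n))/2`.  Let `r` be a prime and `s > 0` with
`r^s ∣ p`, and let `Δ` be the unique polynomial with
`Δ(t)·(1 - t^n)(1 - t^(p-qn)) = (1 - t)(1 - t^(n(p-qn)))`.
If `Δ(t) - t^g` lies in the ideal of `ℤ[t]` generated by `t^(r^s) - 1` and `r`, then
`n² ≡ 1 (mod r^s)` or `q²n² ≡ 1 (mod r^s)`. -/
theorem lens_space_alexander_congruence (p q n r s : ℕ) (hp : 0 < p) (hq : 0 < q)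
    (hpq : Nat.gcd p q = 1) (hn : 0 < n) (hnp : Nat.gcd n p = 1) (hqn : q * n < p)
    (g : ℕ) (hg : 2 * g = n * (p - q * n) + 1 - (p - q * n + n))
    (hr : r.Prime) (hs : 0 < s) (hrsp : r ^ s ∣ p)
    (Δ : Polynomial ℤ)
    (hΔ : Δ * ((1 - X ^ n) * (1 - X ^ (p - q * n))) =
      (1 - X) * (1 - X ^ (n * (p - q * n))))
    (hmem : Δ - X ^ g ∈ Ideal.span {(X ^ (r ^ s) - 1 : Polynomial ℤ),
      ((r : ℤ) : Polynomial ℤ)}) :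
    (n : ZMod (r ^ s)) ^ 2 = 1 ∨ ((q : ZMod (r ^ s)) * (n : ZMod (r ^ s))) ^ 2 = 1 := by
  have := Fact.mk hr
  have hN : 1 < r ^ s := Nat.one_lt_pow hs.ne' hr.one_lt
  have := Fact.mk hN
  have h_unit_n : IsUnit (n : ZMod (r ^ s)) :=
    (ZMod.isUnit_iff_coprime _ _).2 (Nat.Coprime.coprime_dvd_right hrsp hnp)
  have h_unit_q : IsUnit (q : ZMod (r ^ s)) :=
    (ZMod.isUnit_iff_coprime _ _).2 (Nat.Coprime.coprime_dvd_right hrsp (Nat.Coprime.symm hpq))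
  have hb : ((p - q * n : ℕ) : ZMod (r ^ s)) = -(q * n) := by
    rw [Nat.cast_sub hqn.le, (ZMod.natCast_eq_zero_iff _ _).2 hrsp]
    push_cast
    ring
  have h_unit_b : IsUnit ((p - q * n : ℕ) : ZMod (r ^ s)) := hb ▸ (h_unit_q.mul h_unit_n).neg
  have h := coeff_eq_of_sub_X_pow_mem hΔ hmem
  suffices (n : ZMod (r ^ s)) ^ 2 = 1 ∨ ((p - q * n : ℕ) : ZMod (r ^ s)) ^ 2 = 1 by
    rwa [hb, neg_sq] at this
  rcases hr.eq_two_or_odd' with rfl | hodd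
  · refine sq_eq_one_or_of_parity (ZMod.castHom (dvd_pow_self 2 hs.ne') _) h_unit_n h_unit_b
      (fun hsq ↦ ?_) h
    obtain rfl | hs2 : s = 1 ∨ 2 ≤ s := by omega
    · rw [hsq]
      decide
    · have h_sq := congrArg (ZMod.castHom (pow_dvd_pow 2 hs2) (ZMod (2 ^ 2))) hsq
      rw [map_pow, map_neg, map_one] at h_sq
      exact absurd h_sq ((by decide : ∀ u : ZMod (2 ^ 2), u ^ 2 ≠ -1) _)
  · have h2 : IsUnit (2 : ZMod (r ^ s)) := by
      exact_mod_cast (ZMod.isUnit_iff_coprime 2 _).2 hodd.pow.coprime_two_left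
    have h2r : IsUnit (2 : ZMod r) := by
      exact_mod_cast (ZMod.isUnit_iff_coprime 2 _).2 hodd.coprime_two_left
    exact sq_eq_one_or_of_two_ne_zero h2 h2r.ne_zero h_unit_n h_unit_b h
end
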